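/- There exist a universal (plain) decompressor U and a natural number l₀ such that for every binary string x of length l ≥ l₀ the following equivalence holds. Let p_l be the l-th prime, n = p_l − 1, and y = x·0^(n−l). Then x belongs to the halting set H if and only if there exists k with 1 ≤ k < n such that at least half of the k×n matrices A over ZMod 2 satisfy both C_U(enc(A)·f) ≥ n·k + k and C_U(enc(A)·f·0⁹) < n·k + k + 9, where f = A.mulVec y viewed as a binary string of length k. (This is the computational content of the main theorem: the halting problem is decided, with bounded-error randomness over hash matrices, by querying whether such strings are U-random.) -/

import Mathlib

/-- Plain Kolmogorov complexity of `x` under decompressor `V`, in `ℕ∞` (`⊤` if no description). -/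
noncomputable def plainC (V : List Bool →. List Bool) (x : List Bool) : ℕ∞ :=
  sInf {m : ℕ∞ | ∃ d : List Bool, x ∈ V d ∧ (d.length : ℕ∞) = m}

/-- Conditional Kolmogorov complexity of `x` given `y` under conditional decompressor `V`. -/
noncomputable def condC (V : List Bool × List Bool →. List Bool) (x y : List Bool) : ℕ∞ :=
  sInf {m : ℕ∞ | ∃ d : List Bool, x ∈ V (d, y) ∧ (d.length : ℕ∞) = m}

/-- `V` is a universal plain decompressor. -/
def PlainUniversal (V : List Bool →. List Bool) : Prop :=
  Partrec V ∧ ∀ W : List Bool →. List Bool, Partrec W →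
    ∃ c : ℕ, ∀ x : List Bool, plainC V x ≤ plainC W x + c

/-- `V` is a universal conditional decompressor. -/
def CondUniversal (V : List Bool × List Bool →. List Bool) : Prop :=
  Partrec V ∧ ∀ W : List Bool × List Bool →. List Bool, Partrec W →
    ∃ c : ℕ, ∀ x y : List Bool, condC V x y ≤ condC W x y + c

/-- Row-major encoding of a `k × n` binary matrix as a binary string (length `n·k`). -/
def encM {k n : ℕ} (A : Matrix (Fin k) (Fin n) (ZMod 2)) : List Bool :=
  (List.finRange k).flatMap fun i => (List.finRange n).map fun j => decide (A i j = 1)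

/-- The vector in `(ZMod 2)^n` associated to a binary string (of length `n`). -/
def vecOf (n : ℕ) (s : List Bool) : Fin n → ZMod 2 :=
  fun i => if s.getD i false then 1 else 0

/-- The binary string (of length `k`) associated to a vector in `(ZMod 2)^k`. -/
def strOf {k : ℕ} (v : Fin k → ZMod 2) : List Bool :=
  List.ofFn fun i => decide (v i = 1)

/-- The partial recursive code associated to a binary string, via the canonical
computable bijection between `List Bool` and `Nat.Partrec.Code`. -/
def codeOf (x : List Bool) : Nat.Partrec.Code :=
  Denumerable.ofNat Nat.Partrec.Code (Encodable.encode x)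

/-- The halting set: strings whose associated program halts on the empty input. -/
def Halts (x : List Bool) : Prop := ((codeOf x).eval 0).Dom


/-- The event, for a `k × n` matrix `A` and vector `y`, that `enc(A)·f` is `U`-random
but `enc(A)·f·0⁹` is not, where `f = A y` viewed as a string of length `k`. -/
def goodA (U : List Bool →. List Bool) {k n : ℕ} (y : Fin n → ZMod 2)
    (A : Matrix (Fin k) (Fin n) (ZMod 2)) : Prop :=
  ((n * k + k : ℕ) : ℕ∞) ≤ plainC U (encM A ++ strOf (A.mulVec y)) ∧
  plainC U (encM A ++ strOf (A.mulVec y) ++ List.replicate 9 false) <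
    ((n * k + k + 9 : ℕ) : ℕ∞)

namespace RandomStrings

open Primrec

section Primrec

variable {α β σ : Type*} [Primcodable α] [Primcodable β] [Primcodable σ]

theorem primrecPred_exists_mem {f : α → List β} {R : α → β → Prop} (hf : Primrec f)
    (hR : PrimrecRel R) : PrimrecPred fun a => ∃ b ∈ f a, R a b :=
  hR.swap.exists_mem_list.comp hf Primrec.id

theorem primrecPred_forall_mem {f : α → List β} {R : α → β → Prop} (hf : Primrec f)
    (hR : PrimrecRel R) : PrimrecPred fun a => ∀ b ∈ f a, R a b :=
  hR.swap.forall_mem_list.comp hf Primrec.id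

theorem primrecPred_exists_lt {f : α → ℕ} {R : α → ℕ → Prop} (hf : Primrec f)
    (hR : PrimrecRel R) : PrimrecPred fun a => ∃ b < f a, R a b :=
  (primrecPred_exists_mem (list_range.comp hf) hR).of_eq fun a => by simp

theorem primrecPred_forall_lt {f : α → ℕ} {R : α → ℕ → Prop} (hf : Primrec f)
    (hR : PrimrecRel R) : PrimrecPred fun a => ∀ b < f a, R a b :=
  (primrecPred_forall_mem (list_range.comp hf) hR).of_eq fun a => by simp

open Classical in
theorem primrec_length_filter {f : α → List β} {R : α → β → Prop} (hf : Primrec f)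
    (hR : PrimrecRel R) : Primrec fun a => ((f a).filter fun b => R a b).length :=
  list_length.comp (hR.swap.listFilter.comp hf Primrec.id)

theorem primrec_pow {f g : α → ℕ} (hf : Primrec f) (hg : Primrec g) :
    Primrec fun a => f a ^ g a :=
  (Primrec₂.unpaired'.1 Nat.Primrec.pow : Primrec₂ ((· ^ ·) : ℕ → ℕ → ℕ)).comp hf hg

theorem primrecPred_prime : PrimrecPred Nat.Prime := by
  have h : PrimrecPred fun p : ℕ => 2 ≤ p ∧ ∀ m < p, p % m = 0 → m = 1 := by
    refine (nat_le.comp (const 2) Primrec.id).and (primrecPred_forall_lt Primrec.id ?_)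
    refine ((Primrec.eq.comp (nat_mod.comp fst snd) (const 0)).not.or
      (Primrec.eq.comp snd (const 1))).of_eq fun a => ?_
    exact imp_iff_not_or.symm
  refine h.of_eq fun p => ?_
  rw [Nat.prime_def_lt]
  simp only [Nat.dvd_iff_mod_eq_zero]

theorem primrec_count_prime : Primrec (Nat.count Nat.Prime) := by
  classical
  refine (primrec_length_filter (R := fun _ p => Nat.Prime p) list_range
    (primrecPred_prime.comp snd)).of_eq fun n => ?_
  simp only [Nat.count, List.countP_eq_length_filter]
  congr!

end Primrec

/-- The list of all binary strings of length `n`. -/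
def bitStrings (n : ℕ) : List (List Bool) :=
  Nat.rec [[]] (fun _ L => L.map (List.cons false) ++ L.map (List.cons true)) n

theorem bitStrings_succ (n : ℕ) : bitStrings (n + 1) =
    (bitStrings n).map (List.cons false) ++ (bitStrings n).map (List.cons true) := rfl

theorem mem_bitStrings {n : ℕ} {s : List Bool} : s ∈ bitStrings n ↔ s.length = n := by
  induction n generalizing s with
  | zero => simp [bitStrings]
  | succ n ih =>
    rw [bitStrings_succ]
    rcases s with _ | ⟨_ | _, s⟩ <;> simp [ih]

theorem nodup_bitStrings (n : ℕ) : (bitStrings n).Nodup := by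
  induction n with
  | zero => simp [bitStrings]
  | succ n ih =>
    rw [bitStrings_succ, List.nodup_append]
    refine ⟨ih.map (List.cons_injective), ih.map (List.cons_injective), ?_⟩
    simp

theorem length_bitStrings (n : ℕ) : (bitStrings n).length = 2 ^ n := by
  induction n with
  | zero => simp [bitStrings]
  | succ n ih => simp [bitStrings_succ, ih, pow_succ]; ring

theorem primrec_bitStrings : Primrec bitStrings :=
  nat_rec₁ _ <| (list_append.comp
    (list_map snd (list_cons.comp (const false) snd))
    (list_map snd (list_cons.comp (const true) snd)))

/-- The string-level version of `A ↦ A.mulVec y`: the rows of a `k × n` matrix are read from `a`,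
and `x` is implicitly padded with zeros. -/
def hash (n k : ℕ) (a x : List Bool) : List Bool :=
  (List.range k).map fun i => decide
    (((List.range n).filter fun j => a.getD (n * i + j) false && x.getD j false).length % 2 = 1)

theorem primrec_hash {α : Type*} [Primcodable α] {n k : α → ℕ} {a x : α → List Bool}
    (hn : Primrec n) (hk : Primrec k) (ha : Primrec a) (hx : Primrec x) :
    Primrec fun q => hash (n q) (k q) (a q) (x q) := by
  classical
  refine list_map (list_range.comp hk) ?_
  refine (Primrec.eq.comp (nat_mod.comp ?_ (const 2)) (const 1)).decide
  refine (primrec_length_filter (f := fun q : α × ℕ => List.range (n q.1))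
    (R := fun q j => ((a q.1).getD (n q.1 * q.2 + j) false && (x q.1).getD j false) = true)
    (list_range.comp (hn.comp fst)) ?_).of_eq (by simp)
  exact Primrec.eq.comp (Primrec.and.comp
    ((list_getD false).comp (ha.comp (fst.comp fst))
      (nat_add.comp (nat_mul.comp (hn.comp (fst.comp fst)) (snd.comp fst)) snd))
    ((list_getD false).comp (hx.comp (fst.comp fst)) snd)) (const true)

/-- Remove the last `n` bits. -/
def chop (n : ℕ) (z : List Bool) : List Bool := (z.reverse.drop n).reverse

theorem primrec_chop (n : ℕ) : Primrec (chop n) :=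
  list_reverse.comp (list_drop.comp (const n) list_reverse)

theorem chop_append {n : ℕ} (u v : List Bool) (h : v.length = n) : chop n (u ++ v) = u := by
  simp [chop, ← h]

/-- The string ends with `n` zeros. -/
def EndsZ (n : ℕ) (z : List Bool) : Prop := chop n z ++ List.replicate n false = z

instance (n : ℕ) : DecidablePred (EndsZ n) := fun _ => inferInstanceAs (Decidable (_ = _))

theorem endsZ_iff {n : ℕ} {z : List Bool} : EndsZ n z ↔ ∃ u, z = u ++ List.replicate n false :=
  ⟨fun h => ⟨_, h.symm⟩, by rintro ⟨u, rfl⟩; rw [EndsZ, chop_append _ _ (by simp)]⟩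

theorem primrecPred_endsZ (n : ℕ) : PrimrecPred (EndsZ n) :=
  Primrec.eq.comp (list_append.comp (primrec_chop n) (const _)) Primrec.id

/-- Remove nine trailing zeros, provided that they are there and are not preceded by three more. -/
def unpad (w : List Bool) : Option (List Bool) :=
  if EndsZ 9 w ∧ ¬ EndsZ 3 (chop 9 w) then some (chop 9 w) else none

theorem unpad_eq_some {w z : List Bool} :
    unpad w = some z ↔ w = z ++ List.replicate 9 false ∧ ¬ EndsZ 3 z := by
  unfold unpad
  split_ifs with h
  · obtain ⟨h1, h2⟩ := h
    simp only [Option.some.injEq]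
    constructor
    · rintro rfl; exact ⟨h1.symm, h2⟩
    · rintro ⟨rfl, -⟩; exact chop_append _ _ (by simp)
  · simp only [false_iff]
    rintro ⟨rfl, h3⟩
    exact h ⟨endsZ_iff.2 ⟨_, rfl⟩, by rwa [chop_append _ _ (by simp)]⟩

theorem primrec_unpad : Primrec unpad :=
  Primrec.ite ((primrecPred_endsZ 9).and ((primrecPred_endsZ 3).comp (primrec_chop 9)).not)
    (option_some.comp (primrec_chop 9)) (const none)

/-- The number of trailing zeros, a multiple of `20`, chosen by two bits. -/
def zerosFor (b₀ b₁ : Bool) : ℕ := 20 * (2 * b₀.toNat + b₁.toNat + 1)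

/-- Append a run of zeros whose length is determined by the first two bits. -/
def zeroFill (d : List Bool) : List Bool :=
  d ++ List.replicate (zerosFor (d.getD 0 false) (d.getD 1 false)) false

theorem primrec_zeroFill : Primrec zeroFill :=
  list_append.comp Primrec.id ((dom_bool₂ fun b₀ b₁ => List.replicate (zerosFor b₀ b₁) false).comp
    ((list_getD false).comp Primrec.id (const 0)) ((list_getD false).comp Primrec.id (const 1)))

/-- The input after the prefix `P`, if it starts with `P`. -/
def parse (P d : List Bool) : Option (List Bool) :=
  if P ++ d.drop P.length = d then some (d.drop P.length) else none

theorem parse_eq_some {P d e : List Bool} : parse P d = some e ↔ d = P ++ e := by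
  unfold parse
  split_ifs with h
  · simp only [Option.some.injEq]
    constructor
    · rintro rfl; exact h.symm
    · rintro rfl; simp
  · simp only [false_iff]
    rintro rfl
    simp at h

theorem primrec_parse (P : List Bool) : Primrec (parse P) :=
  have h : Primrec fun d : List Bool => d.drop P.length := list_drop.comp (const _) Primrec.id
  Primrec.ite (Primrec.eq.comp (list_append.comp (const P) h) Primrec.id)
    (option_some.comp h) (const none)

/-- Stage `t` of a standard universal decompressor: `1^e 0 d` is mapped to the result of the
`e`-th code on `d`. -/
def stdStage (t : ℕ) (d : List Bool) : Option (List Bool) :=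
  (Nat.Partrec.Code.evaln t (Denumerable.ofNat Nat.Partrec.Code (d.idxOf false))
    (Encodable.encode (d.drop (d.idxOf false + 1)))).bind Encodable.decode

theorem primrec_stdStage : Primrec₂ stdStage := by
  have hi : Primrec fun q : ℕ × List Bool => q.2.idxOf false := list_idxOf.comp (const false) snd
  refine option_bind (Nat.Partrec.Code.primrec_evaln.comp
    ((fst.pair ((Primrec.ofNat Nat.Partrec.Code).comp hi)).pair
      (Primrec.encode.comp (list_drop.comp (succ.comp hi) snd)))) (Primrec.decode.comp snd).to₂

theorem stdStage_mono {t t' : ℕ} (h : t ≤ t') {d z : List Bool} (hz : stdStage t d = some z) :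
    stdStage t' d = some z := by
  unfold stdStage at *
  rw [Option.bind_eq_some_iff] at *
  obtain ⟨a, ha, hz⟩ := hz
  exact ⟨a, Nat.Partrec.Code.evaln_mono h ha, hz⟩

theorem exists_stdStage_of_partrec {W : List Bool →. List Bool} (hW : Partrec W) :
    ∃ e : ℕ, ∀ d z, z ∈ W d → ∃ t, stdStage t (List.replicate e true ++ false :: d) = some z := by
  obtain ⟨c, hc⟩ := Nat.Partrec.Code.exists_code.1 hW
  refine ⟨Encodable.encode c, fun d z hz => ?_⟩
  have hi : (List.replicate (Encodable.encode c) true ++ false :: d).idxOf false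
      = Encodable.encode c := by
    rw [List.idxOf_append_of_notMem (by simp [List.mem_replicate])]
    simp
  have : Encodable.encode z ∈ c.eval (Encodable.encode d) := by
    rw [hc]; simpa using hz
  obtain ⟨t, ht⟩ := Nat.Partrec.Code.evaln_complete.1 this
  refine ⟨t, ?_⟩
  rw [stdStage, hi]
  have hd : (List.replicate (Encodable.encode c) true ++ false :: d).drop (Encodable.encode c + 1)
      = d := by
    rw [show Encodable.encode c + 1 =
      (List.replicate (Encodable.encode c) true ++ [false]).length by simp]
    rw [show List.replicate (Encodable.encode c) true ++ false :: d =
      (List.replicate (Encodable.encode c) true ++ [false]) ++ d by simp, List.drop_left]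
  rw [hd, Denumerable.ofNat_encode, Option.mem_def.1 ht]
  simp

/-- Stage `t` of the enumeration of a sparse set containing every string that is compressed. -/
def Suspect (t : ℕ) (z : List Bool) : Prop :=
  EndsZ 9 z ∨ ∃ j < z.length, ∃ d ∈ bitStrings j,
    (j + 100 < z.length ∧ stdStage t d = some z) ∨
    (j + 91 < z.length ∧ (stdStage t d).bind unpad = some z)

theorem Suspect.mono {t t' : ℕ} (h : t ≤ t') {z : List Bool} (hz : Suspect t z) :
    Suspect t' z := by
  refine hz.imp_right ?_
  rintro ⟨j, hj, d, hd, ⟨h1, h2⟩ | ⟨h1, h2⟩⟩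
  · exact ⟨j, hj, d, hd, .inl ⟨h1, stdStage_mono h h2⟩⟩
  · rw [Option.bind_eq_some_iff] at h2
    obtain ⟨w, h2, h3⟩ := h2
    exact ⟨j, hj, d, hd, .inr ⟨h1, Option.bind_eq_some_iff.2 ⟨w, stdStage_mono h h2, h3⟩⟩⟩

theorem primrecRel_suspect : PrimrecRel Suspect := by
  refine ((primrecPred_endsZ 9).comp snd).or ?_
  refine primrecPred_exists_lt (list_length.comp snd) ?_
  refine primrecPred_exists_mem (primrec_bitStrings.comp snd) ?_
  have hl : ∀ c, PrimrecPred fun q : ((ℕ × List Bool) × ℕ) × List Bool =>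
      q.1.2 + c < q.1.1.2.length := fun c =>
    nat_lt.comp (nat_add.comp (snd.comp fst) (const c)) (list_length.comp (snd.comp (fst.comp fst)))
  have hs : Primrec fun q : ((ℕ × List Bool) × ℕ) × List Bool => stdStage q.1.1.1 q.2 :=
    primrec_stdStage.comp (fst.comp (fst.comp fst)) snd
  have hz : Primrec fun q : ((ℕ × List Bool) × ℕ) × List Bool => some q.1.1.2 :=
    option_some.comp (snd.comp (fst.comp fst))
  exact ((hl 100).and (Primrec.eq.comp hs hz)).or
    ((hl 91).and (Primrec.eq.comp (option_bind hs (primrec_unpad.comp snd)) hz))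

open Classical in
/-- More than half of the matrices `A` are seen by stage `t` to make `enc(A)·Ax` suspect. -/
def MostlySuspect (t n k : ℕ) (x : List Bool) : Prop :=
  2 ^ (n * k) < 2 * ((bitStrings (n * k)).filter fun a => Suspect t (a ++ hash n k a x)).length

theorem MostlySuspect.mono {t t' : ℕ} (h : t ≤ t') {n k : ℕ} {x : List Bool}
    (hz : MostlySuspect t n k x) : MostlySuspect t' n k x := by
  refine lt_of_lt_of_le hz (Nat.mul_le_mul_left 2 (List.Sublist.length_le ?_))
  exact List.monotone_filter_right _ fun a ha => by simpa using Suspect.mono h (by simpa using ha)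

theorem primrecPred_mostlySuspect {α : Type*} [Primcodable α] {t n k : α → ℕ} {x : α → List Bool}
    (ht : Primrec t) (hn : Primrec n) (hk : Primrec k) (hx : Primrec x) :
    PrimrecPred fun q => MostlySuspect (t q) (n q) (k q) (x q) := by
  have hnk := nat_mul.comp hn hk
  refine nat_lt.comp (primrec_pow (const 2) hnk) (nat_mul.comp (const 2) ?_)
  refine primrec_length_filter (primrec_bitStrings.comp hnk) ?_
  exact primrecRel_suspect.comp (ht.comp fst) (list_append.comp snd
    (primrec_hash (hn.comp fst) (hk.comp fst) snd (hx.comp fst)))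

/-- The program of `x` halts on the empty input within `t` steps. -/
def HaltsBy (t : ℕ) (x : List Bool) : Prop :=
  (Nat.Partrec.Code.evaln t (codeOf x) 0).isSome = true

theorem HaltsBy.mono {t t' : ℕ} (h : t ≤ t') {x : List Bool} (hx : HaltsBy t x) :
    HaltsBy t' x := by
  unfold HaltsBy at *
  rw [Option.isSome_iff_exists] at *
  exact hx.imp fun a ha => Nat.Partrec.Code.evaln_mono h ha

theorem halts_iff_haltsBy {x : List Bool} : Halts x ↔ ∃ t, HaltsBy t x := by
  simp only [Halts, HaltsBy, Part.dom_iff_mem, Option.isSome_iff_exists,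
    Nat.Partrec.Code.evaln_complete]
  exact exists_comm

theorem primrecRel_haltsBy : PrimrecRel HaltsBy :=
  Primrec.eq.comp (option_isSome.comp (Nat.Partrec.Code.primrec_evaln.comp
    ((fst.pair ((Primrec.ofNat Nat.Partrec.Code).comp (Primrec.encode.comp snd))).pair
      (const 0)))) (const true)

/-- By stage `t`, the string `x` is known to halt and to have been spoiled at all levels `k'`
with `k < k' < n`. -/
def Selected (t n k : ℕ) (x : List Bool) : Prop :=
  HaltsBy t x ∧ ∀ k' < n, k < k' → MostlySuspect t n k' x

theorem Selected.mono {t t' : ℕ} (h : t ≤ t') {n k : ℕ} {x : List Bool}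
    (hx : Selected t n k x) : Selected t' n k x :=
  ⟨hx.1.mono h, fun k' h1 h2 => (hx.2 k' h1 h2).mono h⟩

theorem primrecPred_selected {α : Type*} [Primcodable α] {t n k : α → ℕ} {x : α → List Bool}
    (ht : Primrec t) (hn : Primrec n) (hk : Primrec k) (hx : Primrec x) :
    PrimrecPred fun q => Selected (t q) (n q) (k q) (x q) := by
  refine (primrecRel_haltsBy.comp ht hx).and (primrecPred_forall_lt hn ?_)
  refine ((nat_lt.comp (hk.comp fst) snd).not.or (primrecPred_mostlySuspect
    (ht.comp fst) (hn.comp fst) snd (hx.comp fst))).of_eq fun a => imp_iff_not_or.symm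

/-- `z` has the form `enc(A)·Ax` with `x` selected by stage `t`. -/
def Witnessed (t : ℕ) (z : List Bool) : Prop :=
  ∃ p < z.length + 1, ∃ k < p - 1, (p.Prime ∧ 1 ≤ k ∧ z.length = p * k) ∧
    ∃ a ∈ bitStrings ((p - 1) * k), ∃ x ∈ bitStrings (Nat.count Nat.Prime p),
      Selected t (p - 1) k x ∧ z = a ++ hash (p - 1) k a x

theorem Witnessed.mono {t t' : ℕ} (h : t ≤ t') {z : List Bool} (hz : Witnessed t z) :
    Witnessed t' z := by
  obtain ⟨p, hp, k, hk, hl, a, ha, x, hx, hs, hz⟩ := hz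
  exact ⟨p, hp, k, hk, hl, a, ha, x, hx, hs.mono h, hz⟩

theorem primrecRel_witnessed : PrimrecRel Witnessed := by
  refine primrecPred_exists_lt (succ.comp (list_length.comp snd)) ?_
  refine primrecPred_exists_lt (nat_sub.comp snd (const 1)) ?_
  refine ((primrecPred_prime.comp (snd.comp fst)).and ((nat_le.comp (const 1) snd).and
    (Primrec.eq.comp (list_length.comp (snd.comp (fst.comp fst)))
      (nat_mul.comp (snd.comp fst) snd)))).and ?_
  refine primrecPred_exists_mem (primrec_bitStrings.comp
    (nat_mul.comp (nat_sub.comp (snd.comp fst) (const 1)) snd)) ?_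
  refine primrecPred_exists_mem (primrec_bitStrings.comp
    (primrec_count_prime.comp (snd.comp (fst.comp fst)))) ?_
  have hn : Primrec fun q : ((((ℕ × List Bool) × ℕ) × ℕ) × List Bool) × List Bool =>
    q.1.1.1.2 - 1 := nat_sub.comp (snd.comp (fst.comp (fst.comp fst))) (const 1)
  have hk : Primrec fun q : ((((ℕ × List Bool) × ℕ) × ℕ) × List Bool) × List Bool =>
    q.1.1.2 := snd.comp (fst.comp fst)
  refine (primrecPred_selected (fst.comp (fst.comp (fst.comp (fst.comp fst)))) hn hk snd).and ?_
  exact Primrec.eq.comp (snd.comp (fst.comp (fst.comp (fst.comp fst))))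
    (list_append.comp (snd.comp fst) (primrec_hash hn hk (snd.comp fst) snd))

/-- Prefix of the descriptions for the standard universal decompressor. -/
def tagStd : List Bool := false :: false :: List.replicate 98 false

/-- Prefix of the descriptions obtained by removing trailing zeros. -/
def tagUnpad : List Bool := true :: false :: List.replicate 89 false

/-- Prefix of the descriptions obtained by appending zeros. -/
def tagFill : List Bool := [false, true]

/-- Prefix of the descriptions of padded witnessed strings. -/
def tagWitness : List Bool := [true, true]

theorem length_tagStd : tagStd.length = 100 := by
  simp only [tagStd, List.length_cons, List.length_replicate]

theorem length_tagUnpad : tagUnpad.length = 91 := by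
  simp only [tagUnpad, List.length_cons, List.length_replicate]

open Classical in
/-- Stage `t` of the decompressor used in the main theorem. -/
noncomputable def stage (d : List Bool) (t : ℕ) : Option (List Bool) :=
  ((parse tagStd d).bind (stdStage t)).orElse fun _ =>
  ((parse tagUnpad d).bind fun e => (stdStage t e).bind unpad).orElse fun _ =>
  ((parse tagFill d).map zeroFill).orElse fun _ =>
  (parse tagWitness d).bind fun e =>
    if Witnessed t e then some (e ++ List.replicate 9 false) else none

theorem primrec_stage : Primrec₂ stage := by
  classical
  have hp : ∀ P, Primrec fun q : List Bool × ℕ => parse P q.1 := fun P =>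
    (primrec_parse P).comp fst
  refine option_orElse.comp (option_bind (hp _)
      (primrec_stdStage.comp (snd.comp fst) snd)) ?_
  refine option_orElse.comp (option_bind (hp _) (option_bind
      (primrec_stdStage.comp (snd.comp fst) snd) (primrec_unpad.comp snd))) ?_
  refine option_orElse.comp (option_map (hp _) (primrec_zeroFill.comp snd)) ?_
  exact option_bind (hp _) (Primrec.ite (primrecRel_witnessed.comp (snd.comp fst) snd)
    (option_some.comp (list_append.comp snd (const _))) (const none))

theorem parse_eq_none {P Q e : List Bool} (h : P.take 2 ≠ Q.take 2) (hP : 2 ≤ P.length)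
    (hQ : 2 ≤ Q.length) : parse P (Q ++ e) = none := by
  rw [Option.eq_none_iff_forall_ne_some]
  intro f hf
  have := congrArg (List.take 2) (parse_eq_some.1 hf)
  rw [List.take_append_of_le_length hP, List.take_append_of_le_length hQ] at this
  exact h this.symm

theorem parse_self (P e : List Bool) : parse P (P ++ e) = some e := parse_eq_some.2 rfl

theorem orElse_eq_some {α : Type*} {o : Option α} {f : Unit → Option α} {z : α} :
    o.orElse f = some z ↔ o = some z ∨ (o = none ∧ f () = some z) := by
  cases o <;> simp [Option.orElse]

theorem stage_eq_some {t : ℕ} {d z : List Bool} : stage d t = some z ↔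
    (∃ e, d = tagStd ++ e ∧ stdStage t e = some z) ∨
    (∃ e, d = tagUnpad ++ e ∧ (stdStage t e).bind unpad = some z) ∨
    (∃ e, d = tagFill ++ e ∧ zeroFill e = z) ∨
    (∃ e, d = tagWitness ++ e ∧ Witnessed t e ∧ e ++ List.replicate 9 false = z) := by
  have l1 : 2 ≤ tagStd.length := by rw [length_tagStd]; norm_num
  have l2 : 2 ≤ tagUnpad.length := by rw [length_tagUnpad]; norm_num
  have l3 : 2 ≤ tagFill.length := le_rfl
  have l4 : 2 ≤ tagWitness.length := le_rfl
  have t1 : tagStd.take 2 = [false, false] := rfl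
  have t2 : tagUnpad.take 2 = [true, false] := rfl
  have t3 : tagFill.take 2 = [false, true] := rfl
  have t4 : tagWitness.take 2 = [true, true] := rfl
  constructor
  · intro h
    simp only [stage, orElse_eq_some, Option.bind_eq_some_iff, parse_eq_some,
      Option.map_eq_some_iff] at h
    rcases h with ⟨e, rfl, h⟩ | ⟨-, ⟨e, rfl, h⟩ | ⟨-, ⟨e, rfl, h⟩ | ⟨-, e, rfl, h⟩⟩⟩
    · exact .inl ⟨e, rfl, h⟩
    · exact .inr (.inl ⟨e, rfl, Option.bind_eq_some_iff.2 h⟩)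
    · exact .inr (.inr (.inl ⟨e, rfl, h⟩))
    · split_ifs at h with hw
      exact .inr (.inr (.inr ⟨e, rfl, hw, by simpa using h⟩))
  · rintro (⟨e, rfl, h⟩ | ⟨e, rfl, h⟩ | ⟨e, rfl, h⟩ | ⟨e, rfl, hw, h⟩)
    · simp [stage, parse_self, h]
    · rw [stage, parse_eq_none (by simp [t1, t2]) l1 l2, parse_self]
      simp [h]
    · rw [stage, parse_eq_none (by simp [t1, t3]) l1 l3, parse_eq_none (by simp [t2, t3]) l2 l3,
        parse_self]
      simp [h]
    · rw [stage, parse_eq_none (by simp [t1, t4]) l1 l4, parse_eq_none (by simp [t2, t4]) l2 l4,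
        parse_eq_none (by simp [t3, t4]) l3 l4, parse_self]
      subst h
      simp only [Option.bind_none, Option.map_none, Option.orElse_none, Option.bind_some, if_pos hw]

theorem stage_mono {t t' : ℕ} (h : t ≤ t') {d z : List Bool} (hz : stage d t = some z) :
    stage d t' = some z := by
  rw [stage_eq_some] at *
  rcases hz with ⟨e, rfl, hz⟩ | ⟨e, rfl, hz⟩ | hz | ⟨e, rfl, hw, hz⟩
  · exact .inl ⟨e, rfl, stdStage_mono h hz⟩
  · rw [Option.bind_eq_some_iff] at hz
    obtain ⟨w, h1, h2⟩ := hz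
    exact .inr (.inl ⟨e, rfl, Option.bind_eq_some_iff.2 ⟨w, stdStage_mono h h1, h2⟩⟩)
  · exact .inr (.inr (.inl hz))
  · exact .inr (.inr (.inr ⟨e, rfl, hw.mono h, hz⟩))

/-- The decompressor used in the main theorem. -/
noncomputable def machine : List Bool →. List Bool := fun d => Nat.rfindOpt (stage d)

theorem mem_machine {d z : List Bool} : z ∈ machine d ↔ ∃ t, stage d t = some z :=
  Nat.rfindOpt_mono fun h => stage_mono h

theorem partrec_machine : Partrec machine := Partrec.rfindOpt primrec_stage.to_comp

theorem plainC_lt_iff {V : List Bool →. List Bool} {z : List Bool} {m : ℕ} :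
    plainC V z < m ↔ ∃ d, z ∈ V d ∧ d.length < m := by
  simp only [plainC, sInf_lt_iff, Set.mem_ofPred_eq]
  constructor
  · rintro ⟨_, ⟨d, hd, rfl⟩, h⟩
    exact ⟨d, hd, by exact_mod_cast h⟩
  · rintro ⟨d, hd, h⟩
    exact ⟨_, ⟨d, hd, rfl⟩, by exact_mod_cast h⟩

theorem plainUniversal_machine : PlainUniversal machine := by
  refine ⟨partrec_machine, fun W hW => ?_⟩
  obtain ⟨e, he⟩ := exists_stdStage_of_partrec hW
  refine ⟨100 + e + 1, fun x => ?_⟩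
  rcases eq_or_ne (plainC W x) ⊤ with htop | htop
  · simp [htop]
  obtain ⟨m, hm⟩ := ENat.ne_top_iff_exists.1 htop
  obtain ⟨d, hd, hdm⟩ : ∃ d, x ∈ W d ∧ d.length < m + 1 := by
    rw [← plainC_lt_iff, ← hm]; exact_mod_cast Nat.lt_succ_self m
  obtain ⟨t, ht⟩ := he d x hd
  have : plainC machine x < ((m + (100 + e + 1) + 1 : ℕ) : ℕ∞) := by
    rw [plainC_lt_iff]
    refine ⟨tagStd ++ (List.replicate e true ++ false :: d),
      mem_machine.2 ⟨t, stage_eq_some.2 (.inl ⟨_, rfl, ht⟩)⟩, ?_⟩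
    rw [List.length_append, length_tagStd]
    simp only [List.length_append, List.length_replicate, List.length_cons]
    omega
  rw [← hm]
  have := Order.le_of_lt_add_one (x := plainC machine x)
    (y := ((m + (100 + e + 1) : ℕ) : ℕ∞)) (by exact_mod_cast this)
  exact_mod_cast this

end RandomStrings
namespace RandomStrings

/-- The finset of binary strings of length `n`. -/
def strs (n : ℕ) : Finset (List Bool) := ⟨bitStrings n, nodup_bitStrings n⟩

theorem mem_strs {n : ℕ} {s : List Bool} : s ∈ strs n ↔ s.length = n := mem_bitStrings

theorem card_strs (n : ℕ) : (strs n).card = 2 ^ n := length_bitStrings n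

open Classical in
theorem card_filter_strs (n : ℕ) (P : List Bool → Prop) :
    ((strs n).filter P).card = ((bitStrings n).filter fun a => P a).length := rfl

theorem card_le_of_descriptions {ι : Type*} {T : Finset ι} {M : ℕ} (r : List Bool → ι → Prop)
    (hr : ∀ s, ∀ a ∈ T, ∀ b ∈ T, r s a → r s b → a = b)
    (h : ∀ a ∈ T, ∃ s, s.length = M ∧ r s a) : T.card ≤ 2 ^ M := by
  choose! g hg using h
  rw [← card_strs]
  refine Finset.card_le_card_of_injOn g (fun a ha => mem_strs.2 (hg a ha).1) fun a ha b hb hab => ?_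
  exact hr (g a) a ha b hb (hg a ha).2 (hab ▸ (hg b hb).2)

theorem card_le_of_short_descriptions {ι : Type*} {T : Finset ι} {M : ℕ}
    (r : List Bool → ι → Prop) (hr : ∀ s, ∀ a ∈ T, ∀ b ∈ T, r s a → r s b → a = b)
    (h : ∀ a ∈ T, ∃ s, s.length < M ∧ r s a) : T.card ≤ 2 ^ M := by
  refine card_le_of_descriptions
    (fun s a => ∃ s' j, s = s' ++ true :: List.replicate j false ∧ r s' a) ?_ ?_
  · rintro _ a ha b hb ⟨s, i, rfl, h1⟩ ⟨s', j, h2, h3⟩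
    have key : ∀ {i j : ℕ} {u v : List Bool}, List.replicate i false ++ true :: u =
        List.replicate j false ++ true :: v → u = v := by
      intro i
      induction i with
      | zero => intro j u v h; cases j <;> simp_all [List.replicate_succ]
      | succ i ih =>
        intro j u v h
        cases j with
        | zero => simp [List.replicate_succ] at h
        | succ j => exact ih (by simpa [List.replicate_succ] using h)
    have := key (i := i) (j := j) (u := s.reverse) (v := s'.reverse)
      (by simpa using congrArg List.reverse h2)
    rw [List.reverse_injective this] at h1
    exact hr _ a ha b hb h1 h3
  · intro a ha
    obtain ⟨s, hs, h⟩ := h a ha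
    exact ⟨_, by simp; omega, s, M - 1 - s.length, rfl, h⟩

theorem exists_common_stage {ι : Type*} (T : Finset ι) {P : ℕ → ι → Prop}
    (hP : ∀ {t t' : ℕ}, t ≤ t' → ∀ {a}, P t a → P t' a) :
    ∃ t, ∀ a ∈ T, (∃ s, P s a) → P t a := by
  classical
  induction T using Finset.induction_on with
  | empty => exact ⟨0, by simp⟩
  | insert a T _ ih =>
    obtain ⟨t, ht⟩ := ih
    by_cases h : ∃ s, P s a
    · obtain ⟨s, hs⟩ := h
      refine ⟨max s t, fun b hb h => ?_⟩
      rcases Finset.mem_insert.1 hb with rfl | hb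
      · exact hP (le_max_left _ _) hs
      · exact hP (le_max_right _ _) (ht b hb h)
    · refine ⟨t, fun b hb h' => ?_⟩
      rcases Finset.mem_insert.1 hb with rfl | hb
      · exact absurd h' h
      · exact ht b hb h'

theorem EndsZ.of_le {i j : ℕ} (h : i ≤ j) {z : List Bool} (hz : EndsZ j z) : EndsZ i z := by
  obtain ⟨u, rfl⟩ := endsZ_iff.1 hz
  refine endsZ_iff.2 ⟨u ++ List.replicate (j - i) false, ?_⟩
  rw [List.append_assoc, List.replicate_append_replicate, Nat.sub_add_cancel h]

theorem endsZ_append_right {j : ℕ} {a f : List Bool} (hj : j ≤ f.length) :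
    EndsZ j (a ++ f) ↔ EndsZ j f := by
  simp only [endsZ_iff]
  constructor
  · rintro ⟨u, hu⟩
    rcases List.append_eq_append_iff.1 hu with ⟨v, rfl, hv⟩ | ⟨v, rfl, hv⟩
    · exact ⟨v, hv⟩
    · have h := congrArg List.length hv
      simp only [List.length_replicate, List.length_append] at h
      have hv0 : v = [] := List.eq_nil_of_length_eq_zero (by omega)
      subst hv0
      exact ⟨[], by simpa using hv.symm⟩
  · rintro ⟨u, rfl⟩
    exact ⟨a ++ u, by simp⟩

theorem EndsZ.of_append {j : ℕ} {a f : List Bool} (h : EndsZ (j + f.length) (a ++ f)) :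
    EndsZ j a := by
  obtain ⟨u, hu⟩ := endsZ_iff.1 h
  rw [← List.replicate_append_replicate, ← List.append_assoc] at hu
  exact endsZ_iff.2 ⟨u, (List.append_inj' hu (by simp)).1⟩

theorem card_endsZ_le (j m : ℕ) (hj : j ≤ m) :
    2 ^ j * ((strs m).filter (EndsZ j)).card ≤ 2 ^ m := by
  have : ((strs m).filter (EndsZ j)).card ≤ 2 ^ (m - j) := by
    refine card_le_of_descriptions (fun s a => a = s ++ List.replicate j false) ?_ ?_
    · rintro s _ - _ - rfl rfl; rfl
    · intro a ha
      obtain ⟨h1, h2⟩ := Finset.mem_filter.1 ha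
      obtain ⟨u, rfl⟩ := endsZ_iff.1 h2
      refine ⟨u, ?_, rfl⟩
      have := mem_strs.1 h1
      simp at this
      omega
  calc _ ≤ 2 ^ j * 2 ^ (m - j) := Nat.mul_le_mul_left _ this
    _ = 2 ^ m := by rw [← pow_add]; congr 1; omega

open Classical in
theorem card_suspect_le (t m : ℕ) (hm : 100 ≤ m) :
    256 * ((strs m).filter (Suspect t)).card ≤ 2 ^ m := by
  have h1 := card_endsZ_le 9 m (by omega)
  have h2 : ((strs m).filter fun z => ∃ d : List Bool,
      d.length < m - 100 ∧ stdStage t d = some z).card ≤ 2 ^ (m - 100) := by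
    refine card_le_of_short_descriptions (fun d z => stdStage t d = some z) ?_ ?_
    · intro s a _ b _ h h'
      exact Option.some.inj (h.symm.trans h')
    · intro a ha
      exact (Finset.mem_filter.1 ha).2
  have h3 : ((strs m).filter fun z => ∃ d : List Bool,
      d.length < m - 91 ∧ (stdStage t d).bind unpad = some z).card ≤ 2 ^ (m - 91) := by
    refine card_le_of_short_descriptions (fun d z => (stdStage t d).bind unpad = some z) ?_ ?_
    · intro s a _ b _ h h'
      exact Option.some.inj (h.symm.trans h')
    · intro a ha
      exact (Finset.mem_filter.1 ha).2
  have hsub : (strs m).filter (Suspect t) ⊆ ((strs m).filter (EndsZ 9)) ∪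
      (((strs m).filter fun z => ∃ d : List Bool,
        d.length < m - 100 ∧ stdStage t d = some z) ∪
      ((strs m).filter fun z => ∃ d : List Bool,
        d.length < m - 91 ∧ (stdStage t d).bind unpad = some z)) := by
    intro z hz
    simp only [Finset.mem_filter, Finset.mem_union, mem_strs] at hz ⊢
    obtain ⟨hl, h | ⟨j, hj, d, hd, ⟨h1, h2⟩ | ⟨h1, h2⟩⟩⟩ := hz
    · exact .inl ⟨hl, h⟩
    · rw [mem_bitStrings] at hd
      exact .inr (.inl ⟨hl, d, by omega, h2⟩)
    · rw [mem_bitStrings] at hd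
      exact .inr (.inr ⟨hl, d, by omega, h2⟩)
  have h4 := (Finset.card_le_card hsub).trans ((Finset.card_union_le _ _).trans
    (Nat.add_le_add_left (Finset.card_union_le _ _) _))
  obtain ⟨q, rfl⟩ := Nat.exists_eq_add_of_le hm
  rw [show 100 + q - 100 = q by omega] at h2 h4
  rw [show 100 + q - 91 = q + 9 by omega] at h3 h4
  rw [pow_add] at h1 h3 ⊢
  norm_num at h1 h3 ⊢
  omega

theorem sq_sum_card_le {ι κ : Type*} [DecidableEq κ] (F : Finset ι) (R : Finset κ)
    (Q : ι → Finset κ) (hQ : ∀ x ∈ F, Q x ⊆ R) :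
    (∑ x ∈ F, (Q x).card) ^ 2 ≤ R.card * ∑ x ∈ F, ∑ x' ∈ F, (Q x ∩ Q x').card := by
  have h1 : ∑ x ∈ F, (Q x).card = ∑ z ∈ R, ∑ x ∈ F, if z ∈ Q x then 1 else 0 := by
    rw [Finset.sum_comm]
    refine Finset.sum_congr rfl fun x hx => ?_
    rw [← Finset.sum_filter, Finset.sum_const, smul_eq_mul, mul_one,
      Finset.filter_mem_eq_inter, Finset.inter_eq_right.2 (hQ x hx)]
  have h2 : ∑ x ∈ F, ∑ x' ∈ F, (Q x ∩ Q x').card =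
      ∑ z ∈ R, (∑ x ∈ F, if z ∈ Q x then 1 else 0) ^ 2 := by
    simp only [sq, Finset.sum_mul_sum]
    rw [Finset.sum_comm]
    rw [Finset.sum_comm (s := R)]
    rw [Finset.sum_comm]
    refine Finset.sum_congr rfl fun x hx => ?_
    rw [Finset.sum_comm]
    refine Finset.sum_congr rfl fun x' hx' => ?_
    simp only [← ite_and, mul_ite, mul_one, mul_zero]
    rw [← Finset.sum_filter, Finset.sum_const, smul_eq_mul, mul_one]
    congr 1
    ext z
    simp only [Finset.mem_inter, Finset.mem_filter]
    have := @hQ x hx z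
    tauto
  rw [h1, h2]
  exact sq_sum_le_card_mul_sum_sq

end RandomStrings

namespace RandomStrings

theorem getElem?_flatMap_of_length_eq {α β : Type*} {f : α → List β} {n j : ℕ} (hj : j < n) :
    ∀ (L : List α) (i : ℕ), (∀ x ∈ L, (f x).length = n) →
      (L.flatMap f)[n * i + j]? = L[i]?.bind fun x => (f x)[j]?
  | [], i, _ => by simp
  | x :: L, 0, h => by
    have hx := h x (by simp)
    rw [List.flatMap_cons, List.getElem?_append_left (by simp; omega)]
    simp
  | x :: L, i + 1, h => by
    have hx := h x (by simp)
    rw [List.flatMap_cons, List.getElem?_append_right (by rw [hx, Nat.mul_succ]; omega), hx,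
      show n * (i + 1) + j - n = n * i + j by rw [Nat.mul_succ]; omega,
      getElem?_flatMap_of_length_eq hj L i fun y hy => h y (by simp [hy])]
    simp

section Matrix

variable {n k : ℕ}

theorem length_encM (A : Matrix (Fin k) (Fin n) (ZMod 2)) : (encM A).length = n * k := by
  simp [encM, List.length_flatMap, mul_comm]

theorem getD_encM (A : Matrix (Fin k) (Fin n) (ZMod 2)) (i : Fin k) (j : Fin n) :
    (encM A).getD (n * i + j) false = decide (A i j = 1) := by
  rw [List.getD_eq_getElem?_getD, encM, getElem?_flatMap_of_length_eq j.2 _ _ (by simp)]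
  simp

theorem zmod_two_eq_of_decide {a b : ZMod 2} (h : decide (a = 1) = decide (b = 1)) : a = b := by
  revert a b; decide

theorem encM_injective :
    Function.Injective (encM : Matrix (Fin k) (Fin n) (ZMod 2) → List Bool) := by
  intro A B h
  ext i j
  exact zmod_two_eq_of_decide (by rw [← getD_encM, ← getD_encM, h])

theorem card_matrix : Fintype.card (Matrix (Fin k) (Fin n) (ZMod 2)) = 2 ^ (n * k) := by
  rw [show Fintype.card (Matrix (Fin k) (Fin n) (ZMod 2)) =
    Fintype.card (Fin k → Fin n → ZMod 2) from Fintype.card_congr (Equiv.refl _)]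
  simp [pow_mul]

theorem image_encM :
    (Finset.univ : Finset (Matrix (Fin k) (Fin n) (ZMod 2))).image encM = strs (n * k) := by
  refine Finset.eq_of_subset_of_card_le ?_ ?_
  · intro s hs
    obtain ⟨A, -, rfl⟩ := Finset.mem_image.1 hs
    exact mem_strs.2 (length_encM A)
  · rw [Finset.card_image_of_injective _ encM_injective, card_strs, Finset.card_univ, card_matrix]

theorem card_filter_strs_eq (P : List Bool → Prop) [DecidablePred P] : ((strs (n * k)).filter P).card =
    Nat.card {A : Matrix (Fin k) (Fin n) (ZMod 2) // P (encM A)} := by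
  classical
  rw [← image_encM, Finset.filter_image, Finset.card_image_of_injective _ encM_injective,
    Nat.card_eq_fintype_card, Fintype.card_subtype]

theorem length_hash (a x : List Bool) : (hash n k a x).length = k := by simp [hash]

theorem strOf_injective : Function.Injective (strOf : (Fin k → ZMod 2) → List Bool) := by
  intro v w h
  ext1 i
  exact zmod_two_eq_of_decide (congrFun (List.ofFn_injective h) i)

theorem hash_encM (A : Matrix (Fin k) (Fin n) (ZMod 2)) (x : List Bool) (r : ℕ) :
    hash n k (encM A) x = strOf (A.mulVec (vecOf n (x ++ List.replicate r false))) := by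
  refine List.ext_getElem (by simp [hash, strOf]) fun i hi _ => ?_
  have hik : i < k := by simpa [hash] using hi
  simp only [hash, strOf, List.getElem_map, List.getElem_range, List.getElem_ofFn]
  congr 1
  have h1 : A.mulVec (vecOf n (x ++ List.replicate r false)) ⟨i, hik⟩ =
      ((((List.range n).filter fun j =>
        (encM A).getD (n * i + j) false && x.getD j false).length : ℕ) : ZMod 2) := by
    have hc : ((Finset.range n).filter fun j =>
        ((encM A).getD (n * i + j) false && x.getD j false) = true).card =
        ((List.range n).filter fun j => decide
          (((encM A).getD (n * i + j) false && x.getD j false) = true)).length := rfl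
    simp only [Bool.decide_eq_true] at hc
    rw [← hc, Finset.card_filter, Nat.cast_sum, Finset.sum_range, Matrix.mulVec, dotProduct]
    refine Finset.sum_congr rfl fun j _ => ?_
    rw [getD_encM A ⟨i, hik⟩ j, vecOf]
    have hx : (x ++ List.replicate r false).getD j false = x.getD j false := by
      simp only [List.getD_eq_getElem?_getD, List.getElem?_append, List.getElem?_replicate]
      split_ifs with h1 h2
      · rfl
      · rw [List.getElem?_eq_none (by omega)]; rfl
      · rw [List.getElem?_eq_none (by omega)]
    rw [hx]
    generalize A ⟨i, hik⟩ j = c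
    generalize x.getD (j : ℕ) false = b
    revert c b; decide
  rw [h1]
  generalize ((List.range n).filter fun j =>
        (encM A).getD (n * i + j) false && x.getD j false).length = c
  have := ZMod.natCast_eq_natCast_iff c 1 2
  rw [Nat.cast_one, Nat.ModEq] at this
  exact propext this.symm

theorem card_mulVec_eq (y : Fin n → ZMod 2) (hy : y ≠ 0) (v : Fin k → ZMod 2) :
    2 ^ k * Nat.card {A : Matrix (Fin k) (Fin n) (ZMod 2) // A.mulVec y = v} = 2 ^ (n * k) := by
  let φ : Matrix (Fin k) (Fin n) (ZMod 2) →+ (Fin k → ZMod 2) :=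
    { toFun := fun A => A.mulVec y
      map_zero' := Matrix.zero_mulVec y
      map_add' := fun A B => Matrix.add_mulVec A B y }
  have hsurj : Function.Surjective φ := by
    intro v
    obtain ⟨j, hj⟩ := Function.ne_iff.1 hy
    have hj1 : y j = 1 := by
      have : ∀ c : ZMod 2, c ≠ 0 → c = 1 := by decide
      exact this _ hj
    refine ⟨Matrix.of fun i j' => if j' = j then v i else 0, ?_⟩
    ext i
    simp [φ, Matrix.mulVec, dotProduct, hj1]
  have hcard := fun w => AddMonoidHom.card_fiber_eq_of_mem_range φ (x := v) (y := w)
    (AddMonoidHom.mem_range.2 (hsurj v)) (AddMonoidHom.mem_range.2 (hsurj w))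
  have := Finset.card_eq_sum_card_fiberwise (f := φ)
    (s := (Finset.univ : Finset (Matrix (Fin k) (Fin n) (ZMod 2))))
    (t := (Finset.univ : Finset (Fin k → ZMod 2))) (by simp)
  rw [Finset.sum_congr rfl fun w _ => (hcard w).symm, Finset.sum_const, Finset.card_univ,
    Finset.card_univ, card_matrix, Fintype.card_fun, ZMod.card, Fintype.card_fin, smul_eq_mul] at this
  rw [this, Nat.card_eq_fintype_card, Fintype.card_subtype]
  rfl

end Matrix

theorem card_hash_eq_hash {n k l : ℕ} (hl : l ≤ n) {x x' : List Bool} (hx : x.length = l)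
    (hx' : x'.length = l) (hne : x ≠ x') :
    2 ^ k * ((strs (n * k)).filter fun a => hash n k a x = hash n k a x').card = 2 ^ (n * k) := by
  have hy : vecOf n x - vecOf n x' ≠ 0 := by
    rw [sub_ne_zero]
    contrapose! hne
    refine List.ext_getElem (by omega) fun i h1 h2 => ?_
    have h := congrFun hne ⟨i, by omega⟩
    simp only [vecOf, List.getD_eq_getElem _ _ h1, List.getD_eq_getElem _ _ h2] at h
    revert h
    generalize x[i] = b
    generalize x'[i] = b'
    revert b b'; decide
  rw [card_filter_strs_eq, ← card_mulVec_eq _ hy 0]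
  congr 1
  refine Nat.card_congr (Equiv.subtypeEquivRight fun A => ?_)
  rw [hash_encM A x 0, hash_encM A x' 0, strOf_injective.eq_iff]
  simp [Matrix.mulVec_sub, sub_eq_zero]

theorem card_hash_eq {n k : ℕ} {x : List Bool} (hx : x.length ≤ n)
    (hne : x ≠ List.replicate x.length false) (f : List Bool) :
    2 ^ k * ((strs (n * k)).filter fun a => hash n k a x = f).card ≤ 2 ^ (n * k) := by
  have hy : vecOf n x ≠ 0 := by
    contrapose! hne
    refine List.ext_getElem (by simp) fun i h1 h2 => ?_
    have h := congrFun hne ⟨i, by omega⟩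
    simp only [vecOf, List.getD_eq_getElem _ _ h1] at h
    simpa using h
  rcases ((strs (n * k)).filter fun a => hash n k a x = f).eq_empty_or_nonempty with h | ⟨a, ha⟩
  · simp [h]
  rw [Finset.mem_filter, ← image_encM, Finset.mem_image] at ha
  obtain ⟨⟨B, -, rfl⟩, hB⟩ := ha
  rw [card_filter_strs_eq, ← card_mulVec_eq _ hy (B.mulVec (vecOf n x))]
  refine Nat.mul_le_mul_left _ (le_of_eq (Nat.card_congr (Equiv.subtypeEquivRight fun A => ?_)))
  rw [← hB, hash_encM A x 0, hash_encM B x 0, strOf_injective.eq_iff]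
  simp

theorem hash_replicate_false (n k l : ℕ) (a : List Bool) :
    hash n k a (List.replicate l false) = List.replicate k false := by
  refine List.ext_getElem (by simp [hash]) fun i hi _ => ?_
  have : ∀ j, (List.replicate l false).getD j false = false := fun j => by
    simp only [List.getD_eq_getElem?_getD, List.getElem?_replicate]
    split_ifs <;> rfl
  simp only [hash, this]
  simp

theorem card_endsZ_hash_le {n k j : ℕ} {x : List Bool} (hj : j ≤ k) (hx : x.length ≤ n)
    (hne : x ≠ List.replicate x.length false) :
    2 ^ j * ((strs (n * k)).filter fun a => EndsZ j (a ++ hash n k a x)).card ≤ 2 ^ (n * k) := by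
  have h1 : ((strs (n * k)).filter fun a => EndsZ j (a ++ hash n k a x)).card =
      ∑ f ∈ (strs k).filter (EndsZ j),
        ((strs (n * k)).filter fun a => hash n k a x = f).card := by
    rw [Finset.card_eq_sum_card_fiberwise (f := fun a => hash n k a x)
      (t := (strs k).filter (EndsZ j))]
    · refine Finset.sum_congr rfl fun f hf => ?_
      rw [Finset.filter_filter]
      congr 1
      refine Finset.filter_congr fun a _ => and_iff_right_of_imp ?_
      rintro rfl
      rw [endsZ_append_right (by rwa [length_hash])]
      exact (Finset.mem_filter.1 hf).2
    · intro a ha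
      have := (Finset.mem_filter.1 ha).2
      rw [endsZ_append_right (by rwa [length_hash])] at this
      exact Finset.mem_filter.2 ⟨mem_strs.2 (length_hash _ _), this⟩
  have h2 := card_endsZ_le j k hj
  have h3 : 2 ^ k * ((strs (n * k)).filter fun a => EndsZ j (a ++ hash n k a x)).card ≤
      ((strs k).filter (EndsZ j)).card * 2 ^ (n * k) := by
    rw [h1, Finset.mul_sum]
    exact Finset.sum_le_card_nsmul _ _ _ fun f _ => card_hash_eq hx hne f
  refine Nat.le_of_mul_le_mul_left ?_ (pow_pos two_pos k)
  calc _ = 2 ^ j * (2 ^ k * _) := by ring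
    _ ≤ 2 ^ j * _ := Nat.mul_le_mul_left _ h3
    _ = (2 ^ j * ((strs k).filter (EndsZ j)).card) * 2 ^ (n * k) := by ring
    _ ≤ _ := Nat.mul_le_mul_right _ h2

end RandomStrings

namespace RandomStrings

theorem mul_card_mostlySuspect_le {t n k l : ℕ} (hl : l ≤ n) (hm : 100 ≤ n * k + k)
    {F : Finset (List Bool)} (hF : ∀ x ∈ F, x.length = l ∧ MostlySuspect t n k x) :
    63 * F.card ≤ 2 ^ k := by
  classical
  let T : List Bool → Finset (List Bool) := fun x =>
    (strs (n * k)).filter fun a => Suspect t (a ++ hash n k a x)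
  let Q : List Bool → Finset (List Bool) := fun x => (T x).image fun a => a ++ hash n k a x
  have hinj : ∀ x, Set.InjOn (fun a => a ++ hash n k a x) (T x) := by
    intro x a _ b _ h
    exact (List.append_inj' h (by simp only [length_hash])).1
  have hQT : ∀ x, (Q x).card = (T x).card := fun x => Finset.card_image_of_injOn (hinj x)
  have hQW : ∀ x, (Q x).card ≤ 2 ^ (n * k) := fun x => by
    rw [hQT, ← card_strs]; exact Finset.card_le_card (Finset.filter_subset _ _)
  have hR : ∀ x ∈ F, Q x ⊆ (strs (n * k + k)).filter (Suspect t) := by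
    intro x _ z hz
    obtain ⟨a, ha, rfl⟩ := Finset.mem_image.1 hz
    obtain ⟨ha, hs⟩ := Finset.mem_filter.1 ha
    refine Finset.mem_filter.2 ⟨mem_strs.2 ?_, hs⟩
    rw [List.length_append, mem_strs.1 ha, length_hash]
  have hcs := sq_sum_card_le F _ Q hR
  have hd := card_suspect_le t _ hm
  have hS : F.card * 2 ^ (n * k) ≤ 2 * ∑ x ∈ F, (Q x).card := by
    rw [Finset.mul_sum, ← smul_eq_mul]
    refine Finset.card_nsmul_le_sum _ _ _ fun x hx => ?_
    rw [hQT]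
    exact (hF x hx).2.le
  have hcoll : 2 ^ k * ∑ x ∈ F, ∑ x' ∈ F, (Q x ∩ Q x').card ≤
      F.card * (2 ^ k * 2 ^ (n * k) + F.card * 2 ^ (n * k)) := by
    rw [Finset.mul_sum]
    refine Finset.sum_le_card_nsmul _ _ _ fun x hx => ?_
    rw [← Finset.add_sum_erase _ _ hx, mul_add]
    refine add_le_add (Nat.mul_le_mul_left _ ?_) ?_
    · rw [Finset.inter_self]; exact hQW x
    · rw [Finset.mul_sum]
      refine (Finset.sum_le_card_nsmul _ _ (2 ^ (n * k)) fun x' hx' => ?_).trans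
        (Nat.mul_le_mul_right _ (Finset.card_le_card (Finset.erase_subset _ _)))
      rw [Finset.mem_erase] at hx'
      rw [← card_hash_eq_hash hl (hF x hx).1 (hF x' hx'.2).1 hx'.1.symm]
      refine Nat.mul_le_mul_left _ ?_
      refine le_trans (Finset.card_le_card ?_) (Finset.card_image_le
        (f := fun a => a ++ hash n k a x))
      intro z hz
      obtain ⟨hz, hz'⟩ := Finset.mem_inter.1 hz
      obtain ⟨a, ha, rfl⟩ := Finset.mem_image.1 hz
      obtain ⟨b, hb, hab⟩ := Finset.mem_image.1 hz'
      obtain ⟨rfl, h⟩ := List.append_inj' hab (by simp only [length_hash])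
      exact Finset.mem_image.2 ⟨b, Finset.mem_filter.2 ⟨(Finset.mem_filter.1 ha).1, h.symm⟩, rfl⟩
  rcases F.eq_empty_or_nonempty with rfl | hne
  · simp
  rw [pow_add] at hd
  have hN : 0 < F.card := hne.card_pos
  have hW : 0 < 2 ^ (n * k) := by positivity
  have hK : 0 < 2 ^ k := by positivity
  generalize ∑ x ∈ F, (Q x).card = S at *
  generalize ∑ x ∈ F, ∑ x' ∈ F, (Q x ∩ Q x').card = D at *
  generalize ((strs (n * k + k)).filter (Suspect t)).card = R at *
  generalize 2 ^ (n * k) = W at *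
  generalize 2 ^ k = K at *
  generalize F.card = N at *
  have h1 : (N * W) ^ 2 ≤ 4 * (R * D) := by
    have := Nat.pow_le_pow_left hS 2
    rw [mul_pow 2 S] at this
    omega
  have h3 : 64 * (K * (N * W) ^ 2) ≤ (W * K) * (N * (K * W + N * W)) := by
    calc 64 * (K * (N * W) ^ 2) ≤ 64 * (K * (4 * (R * D))) := by gcongr
      _ = (256 * R) * (K * D) := by ring
      _ ≤ _ := Nat.mul_le_mul hd hcoll
  have h4 : (N * W ^ 2 * K) * (64 * N) ≤ (N * W ^ 2 * K) * (K + N) := by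
    calc _ = 64 * (K * (N * W) ^ 2) := by ring
      _ ≤ _ := h3
      _ = _ := by ring
  have := Nat.le_of_mul_le_mul_left h4 (by positivity)
  omega

theorem mul_card_selected_le {t n k l : ℕ} (hl : l + 6 ≤ n) (hn : 100 ≤ n) (hk : k < n)
    {F : Finset (List Bool)} (hF : ∀ x ∈ F, x.length = l ∧ Selected t n k x) :
    63 * F.card ≤ 2 ^ (k + 1) := by
  rcases Nat.lt_or_ge (k + 1) n with h | h
  · refine mul_card_mostlySuspect_le (t := t) (n := n) (l := l) (by omega) ?_
      fun x hx => ⟨(hF x hx).1, (hF x hx).2.2 _ h (by omega)⟩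
    nlinarith
  · have h1 : F.card ≤ 2 ^ l := by
      rw [← card_strs]
      exact Finset.card_le_card fun x hx => mem_strs.2 (hF x hx).1
    calc 63 * F.card ≤ 2 ^ 6 * 2 ^ l := Nat.mul_le_mul (by norm_num) h1
      _ = 2 ^ (6 + l) := (pow_add _ _ _).symm
      _ ≤ _ := Nat.pow_le_pow_right two_pos (by omega)

theorem prime_unique {p p' k k' : ℕ} (hp : p.Prime) (hp' : p'.Prime) (hk : 1 ≤ k) (hk' : 1 ≤ k')
    (hkp : k < p) (hkp' : k' < p') (h : p * k = p' * k') : p = p' := by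
  rcases (Nat.Prime.dvd_mul hp).1 (h ▸ dvd_mul_right p k : p ∣ p' * k') with h1 | h1
  · exact (Nat.prime_dvd_prime_iff_eq hp hp').1 h1
  · rcases (Nat.Prime.dvd_mul hp').1 (h ▸ dvd_mul_right p' k' : p' ∣ p * k) with h2 | h2
    · exact ((Nat.prime_dvd_prime_iff_eq hp' hp).1 h2).symm
    · have := Nat.le_of_dvd (by omega) h1
      have := Nat.le_of_dvd (by omega) h2
      omega

theorem witnessed_iff {t l n k : ℕ} {z : List Bool} (hn : n = Nat.nth Nat.Prime l - 1)
    (hk : 1 ≤ k) (hkn : k < n) (hz : z.length = n * k + k) :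
    Witnessed t z ↔ ∃ a x, a.length = n * k ∧ x.length = l ∧ Selected t n k x ∧
      z = a ++ hash n k a x := by
  have hp : (Nat.nth Nat.Prime l).Prime := Nat.nth_mem_of_infinite Nat.infinite_setOfPred_prime l
  have hc : Nat.count Nat.Prime (Nat.nth Nat.Prime l) = l :=
    Nat.count_nth_of_infinite Nat.infinite_setOfPred_prime l
  generalize Nat.nth Nat.Prime l = p at *
  have hzl : z.length = p * k := by
    rw [hz, hn, Nat.sub_mul, one_mul, Nat.sub_add_cancel (Nat.le_mul_of_pos_left k hp.pos)]
  constructor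
  · rintro ⟨p', -, k', hk', ⟨hp', h1, h2⟩, a, ha, x, hx, hs, rfl⟩
    obtain rfl : p = p' := prime_unique hp hp' hk h1 (by omega) (by omega) (hzl.symm.trans h2)
    obtain rfl : k = k' := Nat.eq_of_mul_eq_mul_left hp.pos (hzl.symm.trans h2)
    rw [mem_bitStrings] at ha hx
    subst hn
    exact ⟨a, x, ha, hx.trans hc, hs, rfl⟩
  · rintro ⟨a, x, ha, hx, hs, rfl⟩
    subst hn
    refine ⟨p, ?_, k, hkn, ⟨hp, hk, hzl⟩, a, mem_bitStrings.2 ha, x,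
      mem_bitStrings.2 (hx.trans hc.symm), hs, rfl⟩
    rw [hzl]
    nlinarith

theorem two_mul_add_one_le_nth_prime {l : ℕ} (hl : 1 ≤ l) : 2 * l + 1 ≤ Nat.nth Nat.Prime l := by
  induction l, hl using Nat.le_induction with
  | base => exact Nat.nth_prime_one_eq_three.ge
  | succ l hl ih =>
    have h1 : Nat.nth Nat.Prime l < Nat.nth Nat.Prime (l + 1) :=
      Nat.nth_strictMono Nat.infinite_setOfPred_prime (Nat.lt_succ_self l)
    have hp : ∀ i, (Nat.nth Nat.Prime i).Prime := Nat.nth_mem_of_infinite Nat.infinite_setOfPred_prime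
    have o1 := (hp l).eq_two_or_odd
    have o2 := (hp (l + 1)).eq_two_or_odd
    omega

/-- `z` is random for `machine` although `z·0⁹` is not. -/
def Good (z : List Bool) : Prop :=
  (¬ ∃ d, z ∈ machine d ∧ d.length < z.length) ∧
    ∃ d, z ++ List.replicate 9 false ∈ machine d ∧ d.length < z.length + 9

theorem goodA_machine_iff {n k r : ℕ} (A : Matrix (Fin k) (Fin n) (ZMod 2)) (x : List Bool) :
    goodA machine (vecOf n (x ++ List.replicate r false)) A ↔
      Good (encM A ++ hash n k (encM A) x) := by
  rw [goodA, ← hash_encM, Good, List.length_append, length_encM, length_hash, ← not_lt,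
    plainC_lt_iff, plainC_lt_iff]

theorem mem_machine_iff {d z : List Bool} : z ∈ machine d ↔
    (∃ t e, d = tagStd ++ e ∧ stdStage t e = some z) ∨
    (∃ t e, d = tagUnpad ++ e ∧ (stdStage t e).bind unpad = some z) ∨
    (∃ e, d = tagFill ++ e ∧ zeroFill e = z) ∨
    (∃ t e, d = tagWitness ++ e ∧ Witnessed t e ∧ e ++ List.replicate 9 false = z) := by
  rw [mem_machine]
  simp only [stage_eq_some, exists_or, exists_const]

theorem exists_suspect_of_compressed {z : List Bool} (h : ∃ d, z ∈ machine d ∧ d.length < z.length) :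
    ∃ t, Suspect t z := by
  obtain ⟨d, hd, hl⟩ := h
  rw [mem_machine_iff] at hd
  rcases hd with ⟨t, e, rfl, h⟩ | ⟨t, e, rfl, h⟩ | ⟨e, rfl, h⟩ | ⟨t, e, rfl, -, h⟩
  · rw [List.length_append, length_tagStd] at hl
    exact ⟨t, .inr ⟨e.length, by omega, e, mem_bitStrings.2 rfl, .inl ⟨by omega, h⟩⟩⟩
  · rw [List.length_append, length_tagUnpad] at hl
    exact ⟨t, .inr ⟨e.length, by omega, e, mem_bitStrings.2 rfl, .inr ⟨by omega, h⟩⟩⟩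
  · refine ⟨0, .inl (EndsZ.of_le (j := zerosFor (e.getD 0 false) (e.getD 1 false)) ?_
      (endsZ_iff.2 ⟨e, h.symm⟩))⟩
    unfold zerosFor; omega
  · exact ⟨0, .inl (endsZ_iff.2 ⟨e, h.symm⟩)⟩

theorem good_of_witnessed {t : ℕ} {z : List Bool} (hw : Witnessed t z)
    (hz : ∀ t, ¬ Suspect t z) : Good z := by
  refine ⟨fun h => ?_, tagWitness ++ z, mem_machine_iff.2 (.inr (.inr (.inr ⟨t, z, rfl, hw, rfl⟩))),
    ?_⟩
  · obtain ⟨t, ht⟩ := exists_suspect_of_compressed h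
    exact hz t ht
  · rw [List.length_append, show tagWitness.length = 2 from rfl]
    omega

/-- A halting string is `Good` for at least half of the hash matrices, at some level. -/
theorem exists_level_of_halts {l n : ℕ} {x : List Bool} (hn : n = Nat.nth Nat.Prime l - 1)
    (hl : l + 6 ≤ n) (hn100 : 100 ≤ n) (hx : x.length = l) (hh : Halts x) :
    ∃ k, 1 ≤ k ∧ k < n ∧ ∀ P : List Bool → Prop, ∀ _ : DecidablePred P,
      (∀ a, P a ↔ Good (a ++ hash n k a x)) → 2 ^ (n * k) ≤ 2 * ((strs (n * k)).filter P).card := by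
  classical
  obtain ⟨t₀, ht₀⟩ := halts_iff_haltsBy.1 hh
  have hex : ∃ k, k < n ∧ ∃ t, Selected t n k x :=
    ⟨n - 1, by omega, t₀, ht₀, fun k' h1 h2 => by omega⟩
  obtain ⟨hkn, t₁, ht₁⟩ := Nat.find_spec hex
  have hmin := fun k => Nat.find_min hex (m := k)
  generalize Nat.find hex = k at *
  have hk : 1 ≤ k := by
    by_contra! h0
    obtain rfl : k = 0 := by omega
    have := mul_card_selected_le hl hn100 hkn (F := {x}) (t := t₁) (by simp [hx, ht₁])
    simp at this
  have hns : ∀ t, ¬ MostlySuspect t n k x := by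
    intro t ht
    refine hmin (k - 1) (by omega) ⟨by omega, max t t₁, ht₁.1.mono (le_max_right _ _), ?_⟩
    intro k' h1 h2
    rcases eq_or_lt_of_le (show k ≤ k' by omega) with rfl | h3
    · exact ht.mono (le_max_left _ _)
    · exact (ht₁.2 k' h1 h3).mono (le_max_right _ _)
  refine ⟨k, hk, hkn, fun P _ hP => ?_⟩
  obtain ⟨t, ht⟩ := exists_common_stage (strs (n * k))
    (P := fun t a => Suspect t (a ++ hash n k a x)) fun h _ => Suspect.mono h
  have h1 := hns t
  rw [MostlySuspect, ← card_filter_strs, not_lt] at h1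
  have h2 := Finset.card_filter_add_card_filter_not (s := strs (n * k))
    (fun a => Suspect t (a ++ hash n k a x))
  rw [card_strs] at h2
  have h3 : ((strs (n * k)).filter fun a => ¬ Suspect t (a ++ hash n k a x)).card ≤
      ((strs (n * k)).filter P).card := by
    refine Finset.card_le_card fun a ha => ?_
    obtain ⟨ha, hs⟩ := Finset.mem_filter.1 ha
    refine Finset.mem_filter.2 ⟨ha, (hP a).2 (good_of_witnessed (t := t₁) ?_ fun s h =>
      hs (ht a ha ⟨s, h⟩))⟩
    rw [mem_strs] at ha
    exact (witnessed_iff hn hk hkn (by rw [List.length_append, ha, length_hash])).2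
      ⟨a, x, ha, hx, ht₁, rfl⟩
  omega

end RandomStrings

namespace RandomStrings

theorem good_cases {z : List Bool} (hz : 100 ≤ z.length) (hg : Good z) :
    ¬ EndsZ (zerosFor (z.getD 0 false) (z.getD 1 false)) z ∧
      ((EndsZ 3 z ∧ ∃ t e, e.length + 91 < z.length ∧
          stdStage t e = some (z ++ List.replicate 9 false)) ∨
        EndsZ (zerosFor (z.getD 0 false) (z.getD 1 false) - 9) z ∨ ∃ t, Witnessed t z) := by
  have hc : ∀ b b', 20 ≤ zerosFor b b' ∧ zerosFor b b' ≤ 80 := by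
    intro b b'; cases b <;> cases b' <;> simp [zerosFor]
  have hgetD : ∀ {u v : List Bool} {i : ℕ}, i < u.length →
      (u ++ v).getD i false = u.getD i false := by
    intro u v i h
    rw [List.getD_eq_getElem?_getD, List.getElem?_append_left h, ← List.getD_eq_getElem?_getD]
  obtain ⟨hg, d, hd, hdl⟩ := hg
  constructor
  · intro h
    have hc := hc (z.getD 0 false) (z.getD 1 false)
    obtain ⟨u, hu⟩ := endsZ_iff.1 h
    have hl := congrArg List.length hu
    rw [List.length_append, List.length_replicate] at hl
    refine hg ⟨tagFill ++ u, mem_machine_iff.2 (.inr (.inr (.inl ⟨u, rfl, ?_⟩))), ?_⟩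
    · have h0 : z.getD 0 false = u.getD 0 false := by
        conv_lhs => rw [hu]
        exact hgetD (by omega)
      have h1 : z.getD 1 false = u.getD 1 false := by
        conv_lhs => rw [hu]
        exact hgetD (by omega)
      rw [h0, h1] at hu
      exact hu.symm
    · rw [List.length_append, show tagFill.length = 2 from rfl]
      omega
  · rcases mem_machine_iff.1 hd with ⟨t, e, rfl, h⟩ | ⟨t, e, rfl, h⟩ | ⟨e, rfl, h⟩ | ⟨t, e, rfl, hw, h⟩
    · rw [List.length_append, length_tagStd] at hdl
      refine .inl ⟨?_, t, e, by omega, h⟩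
      by_contra h3
      refine hg ⟨tagUnpad ++ e, mem_machine_iff.2 (.inr (.inl ⟨t, e, rfl, ?_⟩)), ?_⟩
      · rw [h, Option.bind_some, unpad_eq_some]
        exact ⟨rfl, h3⟩
      · rw [List.length_append, length_tagUnpad]
        omega
    · obtain ⟨w, -, h⟩ := Option.bind_eq_some_iff.1 h
      refine absurd ?_ (unpad_eq_some.1 h).2
      exact EndsZ.of_le (j := 9) (by norm_num) (endsZ_iff.2 ⟨z, rfl⟩)
    · refine .inr (.inl ?_)
      have hc := hc (e.getD 0 false) (e.getD 1 false)
      have hl := congrArg List.length h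
      simp only [zeroFill, List.length_append, List.length_replicate] at hl
      have hz : z = e ++ List.replicate (zerosFor (e.getD 0 false) (e.getD 1 false) - 9) false := by
        refine (List.append_inj' (t₁ := List.replicate 9 false) (t₂ := List.replicate 9 false)
          ?_ rfl).1
        rw [List.append_assoc, List.replicate_append_replicate, Nat.sub_add_cancel (by omega)]
        exact h.symm
      have h0 : z.getD 0 false = e.getD 0 false := by
        conv_lhs => rw [hz]
        exact hgetD (by omega)
      have h1 : z.getD 1 false = e.getD 1 false := by
        conv_lhs => rw [hz]
        exact hgetD (by omega)
      rw [h0, h1]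
      exact endsZ_iff.2 ⟨e, hz⟩
    · exact .inr (.inr ⟨t, (List.append_inj' h rfl).1 ▸ hw⟩)

section

open Classical

theorem card_witnessed_le {l n k : ℕ} {x : List Bool} (hn : n = Nat.nth Nat.Prime l - 1)
    (hl : l + 6 ≤ n) (hn100 : 100 ≤ n) (hx : x.length = l) (hh : ¬ Halts x) (hk : 1 ≤ k)
    (hkn : k < n) :
    63 * ((strs (n * k)).filter fun a => ∃ t, Witnessed t (a ++ hash n k a x)).card ≤
      2 * 2 ^ (n * k) := by
  let S : Finset (List Bool) := (strs l).filter fun x => ∃ t, Selected t n k x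
  have hmem : ∀ {x'}, x' ∈ S ↔ x'.length = l ∧ ∃ t, Selected t n k x' := by
    intro x'
    rw [Finset.mem_filter, mem_strs]
  have hS : 63 * S.card ≤ 2 ^ (k + 1) := by
    obtain ⟨t, ht⟩ := exists_common_stage S (P := fun t x => Selected t n k x)
      fun h _ => Selected.mono h
    exact mul_card_selected_le hl hn100 hkn
      fun x hx => ⟨(hmem.1 hx).1, ht x hx (hmem.1 hx).2⟩
  have hsub : ((strs (n * k)).filter fun a => ∃ t, Witnessed t (a ++ hash n k a x)) ⊆
      S.biUnion fun x' => (strs (n * k)).filter fun a => x ≠ x' ∧ hash n k a x = hash n k a x' := by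
    intro a ha
    obtain ⟨ha, t, ht⟩ := Finset.mem_filter.1 ha
    have hal := mem_strs.1 ha
    obtain ⟨a', x', ha', hx', hs, h⟩ :=
      (witnessed_iff hn hk hkn (by rw [List.length_append, hal, length_hash])).1 ht
    obtain ⟨rfl, h⟩ := List.append_inj h (hal.trans ha'.symm)
    refine Finset.mem_biUnion.2 ⟨x', hmem.2 ⟨hx', t, hs⟩, Finset.mem_filter.2 ⟨ha, ?_, h⟩⟩
    rintro rfl
    exact hh (halts_iff_haltsBy.2 ⟨t, hs.1⟩)
  have h1 := (Finset.card_le_card hsub).trans Finset.card_biUnion_le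
  have h2 : 2 ^ k * ∑ x' ∈ S, ((strs (n * k)).filter fun a =>
      x ≠ x' ∧ hash n k a x = hash n k a x').card ≤ S.card * 2 ^ (n * k) := by
    rw [Finset.mul_sum]
    refine Finset.sum_le_card_nsmul _ _ _ fun x' hx' => ?_
    rcases eq_or_ne x x' with rfl | hne
    · simp
    · rw [← card_hash_eq_hash (n := n) (k := k) (by omega) hx (hmem.1 hx').1 hne]
      refine Nat.mul_le_mul_left _ (Finset.card_le_card fun a ha => ?_)
      rw [Finset.mem_filter] at ha ⊢
      exact ⟨ha.1, ha.2.2⟩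
  refine Nat.le_of_mul_le_mul_left ?_ (pow_pos two_pos k)
  calc 2 ^ k * (63 * _) ≤ 2 ^ k * (63 * _) := Nat.mul_le_mul_left _ (Nat.mul_le_mul_left _ h1)
    _ = 63 * (2 ^ k * _) := by ring
    _ ≤ 63 * (S.card * 2 ^ (n * k)) := Nat.mul_le_mul_left _ h2
    _ = (63 * S.card) * 2 ^ (n * k) := by ring
    _ ≤ 2 ^ (k + 1) * 2 ^ (n * k) := Nat.mul_le_mul_right _ hS
    _ = _ := by ring

theorem card_stdStage_le {n k : ℕ} (x : List Bool) (hk : k < 80) (hnk : 100 ≤ n * k) :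
    4096 * ((strs (n * k)).filter fun a => ∃ t e, e.length + 91 < (a ++ hash n k a x).length ∧
      stdStage t e = some (a ++ hash n k a x ++ List.replicate 9 false)).card ≤ 2 ^ (n * k) := by
  have : ((strs (n * k)).filter fun a => ∃ t e, e.length + 91 < (a ++ hash n k a x).length ∧
      stdStage t e = some (a ++ hash n k a x ++ List.replicate 9 false)).card
        ≤ 2 ^ (n * k - 12) := by
    refine card_le_of_short_descriptions (fun e a => ∃ t, stdStage t e =
      some (a ++ hash n k a x ++ List.replicate 9 false)) ?_ ?_
    · rintro e a - b - ⟨t, ht⟩ ⟨t', ht'⟩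
      have := Option.some.inj ((stdStage_mono (le_max_left t t') ht).symm.trans
        (stdStage_mono (le_max_right t t') ht'))
      exact (List.append_inj' (List.append_inj' this rfl).1 (by simp only [length_hash])).1
    · intro a ha
      obtain ⟨ha, t, e, he, h⟩ := Finset.mem_filter.1 ha
      rw [List.length_append, mem_strs.1 ha, length_hash] at he
      exact ⟨e, by omega, t, h⟩
  calc _ ≤ 2 ^ 12 * 2 ^ (n * k - 12) := Nat.mul_le_mul_left _ this
    _ = 2 ^ (n * k) := by rw [← pow_add]; congr 1; omega

theorem card_zerosFor_le {m : ℕ} (k : ℕ) (hm : 2 ≤ m) :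
    4 * ((strs m).filter fun a => k < zerosFor (a.getD 0 false) (a.getD 1 false) ∧
      zerosFor (a.getD 0 false) (a.getD 1 false) < k + 12).card ≤ 2 ^ m := by
  have : ((strs m).filter fun a => k < zerosFor (a.getD 0 false) (a.getD 1 false) ∧
      zerosFor (a.getD 0 false) (a.getD 1 false) < k + 12).card ≤ 2 ^ (m - 2) := by
    refine card_le_of_descriptions (fun s a => ∃ b₀ b₁, a = b₀ :: b₁ :: s) ?_ ?_
    · rintro s a ha b hb ⟨b₀, b₁, rfl⟩ ⟨c₀, c₁, rfl⟩
      have h1 := (Finset.mem_filter.1 ha).2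
      have h2 := (Finset.mem_filter.1 hb).2
      simp only [List.getD_cons_zero, List.getD_cons_succ] at h1 h2
      clear ha hb
      cases b₀ <;> cases b₁ <;> cases c₀ <;> cases c₁ <;> simp [zerosFor] at h1 h2 ⊢ <;> omega
    · intro a ha
      have ha := mem_strs.1 (Finset.mem_filter.1 ha).1
      rcases a with _ | ⟨b₀, _ | ⟨b₁, s⟩⟩
      · simp at ha; omega
      · simp at ha; omega
      · exact ⟨s, by simp at ha; omega, b₀, b₁, rfl⟩
  calc _ ≤ 2 ^ 2 * 2 ^ (m - 2) := Nat.mul_le_mul_left _ this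
    _ = 2 ^ m := by rw [← pow_add]; congr 1; omega

/-- A string that does not halt is `Good` for less than half of the hash matrices. -/
theorem card_good_lt_of_not_halts {l n k : ℕ} {x : List Bool} (hn : n = Nat.nth Nat.Prime l - 1)
    (hl : l + 6 ≤ n) (hn100 : 100 ≤ n) (hx : x.length = l) (hh : ¬ Halts x) (hk : 1 ≤ k)
    (hkn : k < n) :
    2 * ((strs (n * k)).filter fun a => Good (a ++ hash n k a x)).card < 2 ^ (n * k) := by
  have hnk : 100 ≤ n * k := hn100.trans (Nat.le_mul_of_pos_right n hk)
  have hW := Nat.two_pow_pos (n * k)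
  have hwit := card_witnessed_le hn hl hn100 hx hh hk hkn
  have hlen : ∀ a ∈ strs (n * k), (a ++ hash n k a x).length = n * k + k := fun a ha => by
    rw [List.length_append, mem_strs.1 ha, length_hash]
  have hcase : ∀ a ∈ strs (n * k), Good (a ++ hash n k a x) →
      ¬ EndsZ (zerosFor (a.getD 0 false) (a.getD 1 false)) (a ++ hash n k a x) ∧
      ((EndsZ 3 (a ++ hash n k a x) ∧ ∃ t e, e.length + 91 < (a ++ hash n k a x).length ∧
          stdStage t e = some (a ++ hash n k a x ++ List.replicate 9 false)) ∨
        EndsZ (zerosFor (a.getD 0 false) (a.getD 1 false) - 9) (a ++ hash n k a x) ∨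
        ∃ t, Witnessed t (a ++ hash n k a x)) := by
    intro a ha hg
    have := good_cases (by rw [hlen a ha]; omega) hg
    have hal := mem_strs.1 ha
    have hgetD : ∀ i < 2, (a ++ hash n k a x).getD i false = a.getD i false := by
      intro i hi
      rw [List.getD_eq_getElem?_getD, List.getElem?_append_left (by omega),
        ← List.getD_eq_getElem?_getD]
    rwa [hgetD 0 (by norm_num), hgetD 1 (by norm_num)] at this
  have hc : ∀ b b', 20 ≤ zerosFor b b' ∧ zerosFor b b' ≤ 80 := by
    intro b b'; cases b <;> cases b' <;> simp [zerosFor]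
  rcases Classical.em (x ≠ List.replicate x.length false ∧ 3 ≤ k) with ⟨hne, hk3⟩ | hdeg
  · have hends := card_endsZ_hash_le hk3 (by omega : x.length ≤ n) hne
    have hsub : ((strs (n * k)).filter fun a => Good (a ++ hash n k a x)) ⊆
        ((strs (n * k)).filter fun a => EndsZ 3 (a ++ hash n k a x)) ∪
        ((strs (n * k)).filter fun a => ∃ t, Witnessed t (a ++ hash n k a x)) := by
      intro a ha
      obtain ⟨ha, hg⟩ := Finset.mem_filter.1 ha
      rw [Finset.mem_union, Finset.mem_filter, Finset.mem_filter]
      rcases (hcase a ha hg).2 with h | h | h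
      · exact .inl ⟨ha, h.1⟩
      · have := hc (a.getD 0 false) (a.getD 1 false)
        exact .inl ⟨ha, h.of_le (by omega)⟩
      · exact .inr ⟨ha, h⟩
    have := (Finset.card_le_card hsub).trans (Finset.card_union_le _ _)
    have h8 : ((strs (n * k)).filter fun a => EndsZ 3 (a ++ hash n k a x)).card * 8 ≤
        2 ^ (n * k) := by rw [mul_comm]; convert hends; norm_num
    omega
  rw [not_and_or, not_not, not_le] at hdeg
  have hz : x = List.replicate x.length false → ∀ a, hash n k a x = List.replicate k false :=
    fun h a => by rw [h, hash_replicate_false]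
  rcases Nat.lt_or_ge k 80 with hk80 | hk80
  · have hstd := card_stdStage_le x hk80 hnk
    have hband := card_zerosFor_le (m := n * k) k (by omega)
    have hends := card_endsZ_le 3 (n * k) (by omega)
    have hsub : ((strs (n * k)).filter fun a => Good (a ++ hash n k a x)) ⊆
        ((strs (n * k)).filter fun a => ∃ t e, e.length + 91 < (a ++ hash n k a x).length ∧
          stdStage t e = some (a ++ hash n k a x ++ List.replicate 9 false)) ∪
        (((strs (n * k)).filter fun a => ∃ t, Witnessed t (a ++ hash n k a x)) ∪
        (((strs (n * k)).filter (EndsZ 3)) ∪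
        ((strs (n * k)).filter fun a => k < zerosFor (a.getD 0 false) (a.getD 1 false) ∧
          zerosFor (a.getD 0 false) (a.getD 1 false) < k + 12))) := by
      intro a ha
      obtain ⟨ha, hg⟩ := Finset.mem_filter.1 ha
      simp only [Finset.mem_union, Finset.mem_filter, ha, true_and]
      obtain ⟨h0, h | h | h⟩ := hcase a ha hg
      · exact .inl h.2
      · have hc := hc (a.getD 0 false) (a.getD 1 false)
        generalize zerosFor (a.getD 0 false) (a.getD 1 false) = c at *
        rcases Nat.lt_or_ge c (k + 12) with hck | hck
        · refine .inr (.inr (.inr ⟨?_, hck⟩))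
          rcases hdeg with hdeg | hdeg
          · by_contra! hkc
            refine h0 ?_
            rw [hz hdeg, endsZ_append_right (by simpa using hkc)]
            exact endsZ_iff.2 ⟨List.replicate (k - c) false, by
              rw [List.replicate_append_replicate, Nat.sub_add_cancel hkc]⟩
          · omega
        · refine .inr (.inr (.inl (EndsZ.of_append (f := hash n k a x) (h.of_le ?_))))
          rw [length_hash]
          omega
      · exact .inr (.inl h)
    have := (Finset.card_le_card hsub).trans ((Finset.card_union_le _ _).trans
      (Nat.add_le_add_left ((Finset.card_union_le _ _).trans
        (Nat.add_le_add_left (Finset.card_union_le _ _) _)) _))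
    have h8 : ((strs (n * k)).filter (EndsZ 3)).card * 8 ≤ 2 ^ (n * k) := by
      rw [mul_comm]; convert hends; norm_num
    omega
  · have : ((strs (n * k)).filter fun a => Good (a ++ hash n k a x)) = ∅ := by
      refine Finset.filter_eq_empty_iff.2 fun a ha hg => (hcase a ha hg).1 ?_
      have hc := hc (a.getD 0 false) (a.getD 1 false)
      generalize zerosFor (a.getD 0 false) (a.getD 1 false) = c at *
      rw [hz (hdeg.resolve_right (by omega)), endsZ_append_right (by simp; omega)]
      exact endsZ_iff.2 ⟨List.replicate (k - c) false, by
        rw [List.replicate_append_replicate, Nat.sub_add_cancel (by omega)]⟩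
    rw [this, Finset.card_empty]
    omega

end

end RandomStrings

/-- Main theorem, computational content: there is a universal plain decompressor `U`
and a threshold `l₀` such that for every string `x` of length `l ≥ l₀`, `x` halts
iff for some `1 ≤ k < n` (with `n = p_l - 1`, `y = x·0^(n-l)`) at least half of the
`k × n` binary matrices `A` satisfy `C_U(enc(A)·f) ≥ n·k + k` and
`C_U(enc(A)·f·0⁹) < n·k + k + 9`, where `f = A y`. -/
theorem halting_decidable_via_random_strings :
    ∃ U : List Bool →. List Bool, PlainUniversal U ∧
      ∃ l₀ : ℕ, ∀ (l : ℕ) (x : List Bool), x.length = l → l₀ ≤ l →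
        (Halts x ↔ ∃ k : ℕ, 1 ≤ k ∧ k < Nat.nth Nat.Prime l - 1 ∧
          2 ^ ((Nat.nth Nat.Prime l - 1) * k) ≤
            2 * Nat.card {A : Matrix (Fin k) (Fin (Nat.nth Nat.Prime l - 1)) (ZMod 2) //
              goodA U (vecOf (Nat.nth Nat.Prime l - 1)
                (x ++ List.replicate (Nat.nth Nat.Prime l - 1 - l) false)) A}) := by
  classical
  refine ⟨RandomStrings.machine, RandomStrings.plainUniversal_machine, 100, ?_⟩
  intro l x hx hl
  have hp := RandomStrings.two_mul_add_one_le_nth_prime (l := l) (by omega)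
  obtain ⟨n, hn⟩ : ∃ n, n = Nat.nth Nat.Prime l - 1 := ⟨_, rfl⟩
  have hcard : ∀ k, Nat.card {A : Matrix (Fin k) (Fin n) (ZMod 2) //
      goodA RandomStrings.machine (vecOf n (x ++ List.replicate (n - l) false)) A} =
      ((RandomStrings.strs (n * k)).filter fun a =>
        RandomStrings.Good (a ++ RandomStrings.hash n k a x)).card := fun k => by
    rw [RandomStrings.card_filter_strs_eq]
    exact Nat.card_congr (Equiv.subtypeEquivRight fun A => RandomStrings.goodA_machine_iff A x)
  rw [← hn]
  simp only [hcard]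
  constructor
  · intro hh
    obtain ⟨k, hk, hkn, h⟩ :=
      RandomStrings.exists_level_of_halts hn (by omega) (by omega) hx hh
    exact ⟨k, hk, hkn, h _ _ fun _ => Iff.rfl⟩
  · rintro ⟨k, hk, hkn, h⟩
    by_contra hh
    exact absurd h (not_le.2
      (RandomStrings.card_good_lt_of_not_halts hn (by omega) (by omega) hx hh hk hkn))
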